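/- arXiv:2004.13814 — 2 statements merged into one kernel-verified Lean document; each statement's English description precedes it below -/
import Mathlib

section
/- For all integers m, n ≥ 1 and a, b ≥ 1, the numbers of spherical parking functions of the complete bipartite multigraphs K_{m+1,n}^{a,b} and K_{n+1,m}^{a,b} coincide: |sPF(K_{m+1,n}^{a,b})| = |sPF(K_{n+1,m}^{a,b})|. In particular (a = b = 1), |sPF(K_{m+1,n})| = |sPF(K_{n+1,m})|. -/
/-- `dA a A i` is the number of edges from the non-root vertex `i+1` to vertices outside
`A` in the multigraph on `{0,1,…,N}` with adjacency matrix `a`. -/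
def dA {N : ℕ} (a : Fin (N + 1) → Fin (N + 1) → ℕ) (A : Finset (Fin N)) (i : Fin N) : ℕ :=
  a i.succ 0 + ∑ j ∈ Aᶜ, a i.succ j.succ

/-- The set of spherical `G`-parking functions of the multigraph on `{0,…,N}` with
adjacency matrix `a`. -/
def sPF {N : ℕ} (a : Fin (N + 1) → Fin (N + 1) → ℕ) : Set (Fin N → ℕ) :=
  {P | (∀ i, dA a Finset.univ i ≤ P i) ∧
    ∀ A : Finset (Fin N), A.Nonempty → A ≠ Finset.univ → ∃ i ∈ A, P i < dA a A i}

/-- Adjacency matrix of the complete bipartite multigraph `K_{m+1,n}^{a,b}` on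
`{0,1,…,m} ∪ {m+1,…,m+n}` with root `0`: `a` edges between `0` and each `j` with
`m+1 ≤ j`, `b` edges between each `i ∈ {1,…,m}` and each `j ∈ {m+1,…,m+n}`. -/
def Kbip (m n a b : ℕ) : Fin (m + n + 1) → Fin (m + n + 1) → ℕ := fun i j =>
  if i = j then 0
  else if i = 0 then (if m + 1 ≤ (j : ℕ) then a else 0)
  else if j = 0 then (if m + 1 ≤ (i : ℕ) then a else 0)
  else if ((i : ℕ) ≤ m ∧ m + 1 ≤ (j : ℕ)) ∨ ((j : ℕ) ≤ m ∧ m + 1 ≤ (i : ℕ)) then b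
  else 0

/-- The number of spherical parking functions depends only on the multigraph obtained by
deleting the root. -/
theorem ncard_sPF_congr {N N' : ℕ} {a : Fin (N + 1) → Fin (N + 1) → ℕ}
    {a' : Fin (N' + 1) → Fin (N' + 1) → ℕ} (σ : Fin N ≃ Fin N')
    (h : ∀ i j, a' (σ i).succ (σ j).succ = a i.succ j.succ) :
    (sPF a).ncard = (sPF a').ncard := by
  have mem_shift {M M' : ℕ} {c : Fin (M + 1) → Fin (M + 1) → ℕ}
      {c' : Fin (M' + 1) → Fin (M' + 1) → ℕ} (τ : Fin M ≃ Fin M')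
      (hc : ∀ i j, c' (τ i).succ (τ j).succ = c i.succ j.succ)
      {P : Fin M → ℕ} (hP : P ∈ sPF c) :
      (fun k => c' k.succ 0 + (P (τ.symm k) - c (τ.symm k).succ 0)) ∈ sPF c' := by
    obtain ⟨hroot, hsub⟩ := hP
    refine ⟨fun k => by simp [dA], fun A hA hAuniv => ?_⟩
    obtain ⟨i, hi, hlt⟩ := hsub (A.map τ.symm.toEmbedding) (hA.map) fun hmap =>
      hAuniv (Finset.map_injective _ (hmap.trans (Finset.map_univ_equiv τ.symm).symm))
    have hiA : τ i ∈ A := by simpa using hi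
    refine ⟨τ i, hiA, ?_⟩
    have hsum : ∑ j ∈ (A.map τ.symm.toEmbedding)ᶜ, c i.succ j.succ =
        ∑ j ∈ Aᶜ, c' (τ i).succ j.succ :=
      Finset.sum_equiv τ (by simp) fun j _ => (hc i j).symm
    have hi0 := hroot i
    simp only [dA, Finset.compl_univ, Finset.sum_empty, hsum, Equiv.symm_apply_apply] at hi0 hlt ⊢
    omega
  have h' : ∀ i j, a (σ.symm i).succ (σ.symm j).succ = a' i.succ j.succ := fun i j => by
    simpa using (h (σ.symm i) (σ.symm j)).symm
  refine Set.BijOn.ncard_eq (Set.InvOn.bijOn ⟨fun P hP => ?_, fun P hP => ?_⟩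
    (fun _ => mem_shift σ h) (fun _ => mem_shift σ.symm h'))
  all_goals
    funext k
    have hk := hP.1 k
    simp only [dA, Finset.compl_univ, Finset.sum_empty] at hk
    simp
    omega

/-- Deleting the root, `K_{m+1,n}^{a,b}` and `K_{n+1,m}^{a,b}` become isomorphic by swapping
the two parts. -/
theorem Kbip_finAddFlip (m n a b : ℕ) (i j : Fin (m + n)) :
    Kbip n m a b (finAddFlip i).succ (finAddFlip j).succ = Kbip m n a b i.succ j.succ := by
  induction i using Fin.addCases <;> induction j using Fin.addCases <;>
    simp [Kbip, Fin.ext_iff] <;> grind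

/-- `|sPF(K_{m+1,n}^{a,b})| = |sPF(K_{n+1,m}^{a,b})|`; in particular
`|sPF(K_{m+1,n})| = |sPF(K_{n+1,m})|`. -/
theorem stmt5 (m n a b : ℕ) (hm : 1 ≤ m) (hn : 1 ≤ n) (ha : 1 ≤ a) (hb : 1 ≤ b) :
    (sPF (Kbip m n a b)).ncard = (sPF (Kbip n m a b)).ncard ∧
    (sPF (Kbip m n 1 1)).ncard = (sPF (Kbip n m 1 1)).ncard := by
  exact ⟨ncard_sPF_congr finAddFlip (Kbip_finAddFlip m n a b),
    ncard_sPF_congr finAddFlip (Kbip_finAddFlip m n 1 1)⟩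
end

section
/- For all integers m, n ≥ 1 and a, b ≥ 1, |sPF(K_{m+1,n}^{a,b})| = b^{m+n} · |sPF(K_{m+1,n})|. -/
/-- If all the degrees `dA` of `g` are an affine image, of slope `b`, of those of `g₀`, and no
vertex of `g₀` is adjacent to the root, then spherical parking functions of `g` are obtained
from those of `g₀` by the choice of a remainder modulo `b` at each non-root vertex. -/
theorem ncard_sPF_eq_of_affine {N b : ℕ} (hb : 1 ≤ b) {g g₀ : Fin (N + 1) → Fin (N + 1) → ℕ}
    (c : Fin N → ℕ) (h : ∀ A i, dA g A i = c i + b * dA g₀ A i)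
    (h₀ : ∀ i, dA g₀ Finset.univ i = 0) :
    (sPF g).ncard = b ^ N * (sPF g₀).ncard := by
  let f : (Fin N → ℕ) × (Fin N → Fin b) → Fin N → ℕ :=
    fun x i => c i + (b * x.1 i + (x.2 i : ℕ))
  have hf : Function.Injective f := by
    rintro ⟨Q, r⟩ ⟨Q', r'⟩ hx
    have hi (i : Fin N) : b * Q i + (r i : ℕ) = b * Q' i + (r' i : ℕ) :=
      Nat.add_left_cancel (congrFun hx i)
    refine Prod.ext (funext fun i => ?_) (funext fun i => Fin.ext ?_)
    · simpa [Nat.mul_add_div hb, Nat.div_eq_of_lt] using congrArg (· / b) (hi i)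
    · simpa [Nat.mul_add_mod, Nat.mod_eq_of_lt] using congrArg (· % b) (hi i)
  have key (Q : Fin N → ℕ) (r : Fin N → Fin b) : f (Q, r) ∈ sPF g ↔ Q ∈ sPF g₀ := by
    have hlt (A : Finset (Fin N)) (i : Fin N) : f (Q, r) i < dA g A i ↔ Q i < dA g₀ A i := by
      rw [h, Nat.add_lt_add_iff_left, mul_comm b (dA g₀ A i), ← Nat.div_lt_iff_lt_mul hb,
        Nat.mul_add_div hb, Nat.div_eq_of_lt (r i).isLt, add_zero]
    have hge (i : Fin N) : dA g Finset.univ i ≤ f (Q, r) i := by simp [h, h₀, f]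
    simp [sPF, hlt, hge, h₀]
  have himage : sPF g = f '' (sPF g₀ ×ˢ Set.univ) := by
    ext P
    constructor
    · intro hP
      have hP' : f (fun i => (P i - c i) / b, fun i => ⟨(P i - c i) % b, Nat.mod_lt _ hb⟩) = P := by
        funext i
        have hc := hP.1 i
        rw [h, h₀, mul_zero, add_zero] at hc
        simp only [f, Nat.div_add_mod]
        omega
      exact ⟨_, ⟨(key _ _).1 (hP'.symm ▸ hP), trivial⟩, hP'⟩
    · rintro ⟨⟨Q, r⟩, ⟨hQ, -⟩, rfl⟩
      exact (key Q r).2 hQ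
  rw [himage, Set.ncard_image_of_injective _ hf, Set.ncard_prod, Set.ncard_univ,
    Nat.card_eq_fintype_card, Fintype.card_fun, Fintype.card_fin, Fintype.card_fin, mul_comm]

theorem Kbip_succ_zero (m n a b : ℕ) (i : Fin (m + n)) :
    Kbip m n a b i.succ 0 = if m ≤ (i : ℕ) then a else 0 := by
  simp [Kbip, Fin.succ_ne_zero]

theorem Kbip_succ_succ (m n a b : ℕ) (i j : Fin (m + n)) :
    Kbip m n a b i.succ j.succ = b * Kbip m n 0 1 i.succ j.succ := by
  simp [Kbip, Fin.succ_ne_zero]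

theorem dA_Kbip (m n a b : ℕ) (A : Finset (Fin (m + n))) (i : Fin (m + n)) :
    dA (Kbip m n a b) A i = (if m ≤ (i : ℕ) then a else 0) + b * dA (Kbip m n 0 1) A i := by
  simp only [dA, Kbip_succ_zero, Kbip_succ_succ m n a b, ite_self, zero_add, Finset.mul_sum]

theorem ncard_sPF_Kbip (m n a b : ℕ) (hb : 1 ≤ b) :
    (sPF (Kbip m n a b)).ncard = b ^ (m + n) * (sPF (Kbip m n 0 1)).ncard :=
  ncard_sPF_eq_of_affine hb _ (dA_Kbip m n a b) fun i => by simp [dA, Kbip_succ_zero]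

/-- `|sPF(K_{m+1,n}^{a,b})| = b^{m+n} · |sPF(K_{m+1,n})|`. -/
theorem stmt7 (m n a b : ℕ) (hm : 1 ≤ m) (hn : 1 ≤ n) (ha : 1 ≤ a) (hb : 1 ≤ b) :
    (sPF (Kbip m n a b)).ncard = b ^ (m + n) * (sPF (Kbip m n 1 1)).ncard := by
  rw [ncard_sPF_Kbip m n a b hb, ncard_sPF_Kbip m n 1 1 le_rfl, one_pow, one_mul]
end
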